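/- Let V : ℤ^d → ℝ be L-periodic, i.e. V(n + kL) = V(n) for all n, k ∈ ℤ^d where kL = (k_i L_i)_i and L = (L_i)_i has positive integer components. Let C = ∏_{i=1}^d [a_i, a_i + L_i − 1] be any period cell of V. Then inf σ(h_0 + V) = min σ(h^P_{0,C} + V|_C), the least eigenvalue of the periodic restriction on ℓ²(C). -/

import Mathlib

open scoped BigOperators

noncomputable section

/-- Points of the lattice `ℤ^d`. -/
abbrev Zd (d : ℕ) := Fin d → ℤ

/-- 1-norm distance on `ℤ^d`. -/
def dist1 {d : ℕ} (x y : Zd d) : ℤ := ∑ i, |x i - y i|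

/-- The set of nearest neighbors of a point of `ℤ^d`. -/
def nbhd {d : ℕ} (n : Zd d) : Finset (Zd d) :=
  (Fintype.piFinset fun i => Finset.Icc (n i - 1) (n i + 1)).filter fun m => dist1 n m = 1

/-- A discrete box `∏ [lo i, hi i]`. -/
def dbox {d : ℕ} (lo hi : Zd d) : Finset (Zd d) :=
  Fintype.piFinset fun i => Finset.Icc (lo i) (hi i)

/-- The representative of `m ∈ ℤ^d` in the period cell `∏ [a i, a i + L i - 1]`
modulo `L`. -/
def reduceTo {d : ℕ} (a L : Zd d) (m : Zd d) : Zd d :=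
  fun i => a i + (m i - a i) % L i

/-- The matrix of the periodic Laplacian `h^P_{0,C}` plus a potential `V` on the period
cell `C = ∏ [a i, a i + L i - 1]`:  `(h^P_{0,C}u)(n) = (h₀ u_T)(n)` where `u_T` is the
`L`-periodic extension of `u`.  The entry at `(i, j)` counts (with sign `-1`) the
nearest neighbors of `i` congruent to `j` modulo `L`. -/
def periodicMat {d : ℕ} (a L : Zd d) (V : Zd d → ℝ) :
    Matrix (dbox a (fun i => a i + L i - 1)) (dbox a (fun i => a i + L i - 1)) ℝ :=
  fun i j => (-(((nbhd (i : Zd d)).filter fun m => reduceTo a L m = (j : Zd d)).card : ℝ))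
    + (if i = j then V (i : Zd d) else 0)

section Lattice

open Finset

variable {d : ℕ}

lemma mem_nbhd_iff {n m : Zd d} : m ∈ nbhd n ↔ dist1 n m = 1 := by
  refine ⟨fun h => (mem_filter.mp h).2, fun h => mem_filter.mpr ⟨?_, h⟩⟩
  refine Fintype.mem_piFinset.mpr fun i => ?_
  have hi : |n i - m i| ≤ 1 := by
    rw [← h]
    exact single_le_sum (f := fun i => |n i - m i|) (fun _ _ => abs_nonneg _) (mem_univ i)
  rw [abs_le] at hi
  rw [mem_Icc]
  omega

lemma dist1_comm (n m : Zd d) : dist1 n m = dist1 m n := by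
  simp only [dist1, abs_sub_comm]

lemma notMem_nbhd_self (n : Zd d) : n ∉ nbhd n := by
  simp [mem_nbhd_iff, dist1]

lemma sum_nbhd_add {M : Type*} [AddCommMonoid M] (n t : Zd d) (f : Zd d → M) :
    ∑ m ∈ nbhd (n + t), f m = ∑ m ∈ nbhd n, f (m + t) := by
  refine sum_nbij' (fun m => m - t) (fun m => m + t) ?_ ?_ ?_ ?_ ?_
  · intro m hm
    simp only [mem_nbhd_iff, dist1, Pi.add_apply, Pi.sub_apply] at hm ⊢
    simpa only [sub_sub_eq_add_sub] using hm
  · intro m hm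
    simp only [mem_nbhd_iff, dist1, Pi.add_apply] at hm ⊢
    simpa only [add_sub_add_right_eq_sub] using hm
  all_goals simp

variable (a : Zd d) {L : Zd d} (hL : ∀ i, 0 < L i)

lemma reduceTo_add_mul (n k : Zd d) : reduceTo a L (n + k * L) = reduceTo a L n := by
  funext i
  simp only [reduceTo, Pi.add_apply, Pi.mul_apply, add_sub_right_comm, Int.add_mul_emod_self_right]

lemma reduceTo_add_quotient (n : Zd d) : reduceTo a L n + (n - a) / L * L = n := by
  funext i
  have := Int.emod_add_mul_ediv (n i - a i) (L i)
  simp only [reduceTo, Pi.add_apply, Pi.mul_apply, Pi.div_apply, Pi.sub_apply]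
  linarith [mul_comm (L i) ((n i - a i) / L i)]

include hL in
lemma reduceTo_mem (n : Zd d) : reduceTo a L n ∈ dbox a (fun i => a i + L i - 1) := by
  refine Fintype.mem_piFinset.mpr fun i => mem_Icc.mpr ?_
  have h₁ := Int.emod_nonneg (n i - a i) (hL i).ne'
  have h₂ := Int.emod_lt_of_pos (n i - a i) (hL i)
  simp only [reduceTo]
  omega

lemma reduceTo_of_mem {n : Zd d} (hn : n ∈ dbox a (fun i => a i + L i - 1)) :
    reduceTo a L n = n := by
  funext i
  have : a i ≤ n i ∧ n i ≤ a i + L i - 1 := mem_Icc.mp (Fintype.mem_piFinset.mp hn i)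
  simp only [reduceTo]
  rw [Int.emod_eq_of_lt (by omega) (by omega)]
  ring

lemma reduceTo_eq_iff {n c : Zd d} (hc : c ∈ dbox a (fun i => a i + L i - 1)) :
    reduceTo a L n = c ↔ ∃ k : Zd d, n = c + k * L := by
  constructor
  · rintro rfl
    exact ⟨_, (reduceTo_add_quotient a n).symm⟩
  · rintro ⟨k, rfl⟩
    rw [reduceTo_add_mul, reduceTo_of_mem a hc]

/-- Every lattice point is uniquely a point of the period cell plus a period. -/
def cellEquiv : dbox a (fun i => a i + L i - 1) × Zd d ≃ Zd d where
  toFun p := (p.1 : Zd d) + p.2 * L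
  invFun n := (⟨reduceTo a L n, reduceTo_mem a hL n⟩, (n - a) / L)
  left_inv := by
    rintro ⟨⟨c, hc⟩, k⟩
    have h : reduceTo a L (c + k * L) = c := (reduceTo_eq_iff a hc).mpr ⟨k, rfl⟩
    refine Prod.ext (Subtype.ext h) ?_
    have h' := reduceTo_add_quotient a (L := L) (c + k * L)
    rw [h] at h'
    funext i
    have := congrFun h' i
    exact mul_right_cancel₀ (hL i).ne' (add_left_cancel this)
  right_inv n := reduceTo_add_quotient a n

end Lattice

section PeriodicMatrix

variable {d : ℕ} (a : Zd d) {L : Zd d} (hL : ∀ i, 0 < L i) (V : Zd d → ℝ)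

open Finset Matrix

include hL in
lemma periodicMat_mulVec {f : Zd d → ℝ} (hf : ∀ n, f (reduceTo a L n) = f n)
    (c : dbox a (fun i => a i + L i - 1)) :
    (periodicMat a L V *ᵥ fun j => f j) c = -∑ m ∈ nbhd (c : Zd d), f m + V c * f c := by
  have h : ∑ m ∈ nbhd (c : Zd d), f m = ∑ j : dbox a (fun i => a i + L i - 1),
      (((nbhd (c : Zd d)).filter fun m => reduceTo a L m = (j : Zd d)).card : ℝ) * f j := by
    rw [← sum_fiberwise (nbhd (c : Zd d))
      (fun m => (⟨reduceTo a L m, reduceTo_mem a hL m⟩ : dbox a (fun i => a i + L i - 1)))]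
    refine sum_congr rfl fun j _ => ?_
    simp only [Subtype.ext_iff]
    rw [← nsmul_eq_mul, ← sum_const]
    refine sum_congr rfl fun m hm => ?_
    rw [← hf m, (mem_filter.mp hm).2]
  rw [h, mulVec, dotProduct, ← sum_neg_distrib]
  simp [periodicMat, add_mul, sum_add_distrib]

lemma periodicMat_isHermitian : (periodicMat a L V).IsHermitian := by
  refine IsHermitian.ext fun i j => ?_
  have key : ∀ i j : dbox a (fun i => a i + L i - 1), ∀ m : Zd d,
      m ∈ (nbhd (i : Zd d)).filter (fun m => reduceTo a L m = (j : Zd d)) →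
      (i + j - m : Zd d) ∈ (nbhd (j : Zd d)).filter (fun m => reduceTo a L m = (i : Zd d)) := by
    intro i j m hm
    obtain ⟨h₁, h₂⟩ := mem_filter.mp hm
    obtain ⟨k, hk⟩ := (reduceTo_eq_iff a j.2).mp h₂
    refine mem_filter.mpr ⟨?_, (reduceTo_eq_iff a i.2).mpr ⟨-k, ?_⟩⟩
    · rw [mem_nbhd_iff] at h₁ ⊢
      refine Eq.trans ?_ ((dist1_comm m i).trans h₁)
      simp only [dist1, Pi.add_apply, Pi.sub_apply]
      refine sum_congr rfl fun l _ => ?_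
      congr 1
      ring
    · rw [hk]
      ring
  have hcard : ((nbhd (j : Zd d)).filter fun m => reduceTo a L m = (i : Zd d)).card =
      ((nbhd (i : Zd d)).filter fun m => reduceTo a L m = (j : Zd d)).card :=
    card_nbij' (fun m => j + i - m) (fun m => i + j - m) (key j i) (key i j)
      (fun m _ => by simp [add_comm]) (fun m _ => by simp [add_comm])
  simp only [periodicMat, star_trivial, hcard, eq_comm (a := j) (b := i)]
  split_ifs with h
  · rw [h]
  · rfl

include hL in
lemma exists_isLeast_spectrum_periodicMat :
    ∃ E : ℝ, IsLeast (spectrum ℝ (periodicMat a L V)) E ∧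
      (∃ v ≠ 0, periodicMat a L V *ᵥ v = E • v) ∧
      ∀ w, E * (w ⬝ᵥ w) ≤ w ⬝ᵥ (periodicMat a L V *ᵥ w) := by
  have hA := periodicMat_isHermitian a (L := L) V
  have : Nonempty (dbox a (fun i => a i + L i - 1)) := ⟨⟨_, reduceTo_mem a hL a⟩⟩
  obtain ⟨i, hi⟩ := Finite.exists_min hA.eigenvalues
  have hleast : IsLeast (spectrum ℝ (periodicMat a L V)) (hA.eigenvalues i) := by
    rw [hA.spectrum_real_eq_range_eigenvalues]
    exact ⟨⟨i, rfl⟩, by rintro _ ⟨j, rfl⟩; exact hi j⟩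
  refine ⟨_, hleast, ⟨_, ?_, hA.mulVec_eigenvectorBasis i⟩, fun w => ?_⟩
  · intro h
    apply hA.eigenvectorBasis.orthonormal.ne_zero i
    ext j
    exact congrFun h j
  · have hpos : (periodicMat a L V - algebraMap ℝ _ (hA.eigenvalues i)).PosSemidef := by
      rw [posSemidef_iff_isHermitian_and_spectrum_nonneg]
      refine ⟨hA.sub ?_, ?_⟩
      · simp [IsHermitian, algebraMap_eq_diagonal]
      · rw [← spectrum.sub_singleton_eq]
        rintro _ ⟨x, hx, _, rfl, rfl⟩
        exact sub_nonneg.mpr (hleast.2 hx)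
    have := hpos.dotProduct_mulVec_nonneg w
    rw [sub_mulVec, Algebra.algebraMap_eq_smul_one, smul_mulVec, one_mulVec, dotProduct_sub,
      dotProduct_smul, star_trivial, smul_eq_mul] at this
    linarith

end PeriodicMatrix

section Spectrum

lemma mem_spectrum_of_forall_exists_norm_le {F : Type*} [NormedAddCommGroup F]
    [NormedSpace ℝ F] {T : F →L[ℝ] F} {E : ℝ}
    (h : ∀ η > 0, ∃ u ≠ 0, ‖T u - E • u‖ ≤ η * ‖u‖) : E ∈ spectrum ℝ T := by
  rintro ⟨S, hS⟩
  have hbound : ∀ u, ‖u‖ ≤ ‖(↑S⁻¹ : F →L[ℝ] F)‖ * ‖T u - E • u‖ := by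
    intro u
    have hinv : (↑S⁻¹ : F →L[ℝ] F) ((↑S : F →L[ℝ] F) u) = u :=
      DFunLike.congr_fun (Units.inv_mul S) u
    have hSu : (↑S : F →L[ℝ] F) u = E • u - T u := by
      rw [hS, Algebra.algebraMap_eq_smul_one]
      rfl
    calc ‖u‖ = ‖(↑S⁻¹ : F →L[ℝ] F) ((↑S : F →L[ℝ] F) u)‖ := by rw [hinv]
      _ ≤ ‖(↑S⁻¹ : F →L[ℝ] F)‖ * ‖(↑S : F →L[ℝ] F) u‖ := ContinuousLinearMap.le_opNorm _ _
      _ = _ := by rw [hSu, norm_sub_rev]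
  obtain ⟨η, hη, hlt⟩ := exists_pos_mul_lt one_pos ‖(↑S⁻¹ : F →L[ℝ] F)‖
  obtain ⟨u, hu0, hu⟩ := h η hη
  have h₁ := (hbound u).trans (mul_le_mul_of_nonneg_left hu (norm_nonneg _))
  nlinarith [norm_pos_iff.mpr hu0]

lemma le_of_mem_spectrum_of_forall_le_inner {F : Type*} [NormedAddCommGroup F]
    [InnerProductSpace ℝ F] [CompleteSpace F] {T : F →L[ℝ] F} {E : ℝ}
    (hE : ∀ u, E * ‖u‖ ^ 2 ≤ inner ℝ u (T u)) {x : ℝ} (hx : x ∈ spectrum ℝ T) : E ≤ x := by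
  by_contra! h
  refine hx (IsUnit.sub_iff.mp ?_)
  refine ContinuousLinearMap.isUnit_of_forall_le_norm_inner_map _
    (c := ⟨E - x, (sub_pos.mpr h).le⟩) (sub_pos.mpr h) fun u => ?_
  refine le_trans ?_ (le_abs_self _)
  change ‖u‖ ^ 2 * (E - x) ≤ _
  have hval : (T - algebraMap ℝ (F →L[ℝ] F) x) u = T u - x • u := by
    rw [Algebra.algebraMap_eq_smul_one]
    rfl
  rw [hval, inner_sub_left, real_inner_smul_left, real_inner_self_eq_norm_sq, real_inner_comm]
  linarith [hE u]

end Spectrum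

section LowerBound

open Finset

variable {d : ℕ} (a : Zd d) {L : Zd d} (hL : ∀ i, 0 < L i)

/-- The restriction of a square-summable function to the coset `n + ∏ L i ℤ`. -/
def periodSlice (u : lp (fun _ : Zd d => ℝ) 2) (n : Zd d) : lp (fun _ : Zd d => ℝ) 2 :=
  ⟨fun k => u (n + k * L), by
    have hinj : Function.Injective fun k : Zd d => n + k * L := fun k l h =>
      funext fun i => mul_right_cancel₀ (hL i).ne' (congrFun (add_left_cancel h) i)
    exact memℓp_gen (((lp.memℓp u).summable (by norm_num)).comp_injective hinj)⟩

@[simp]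
lemma periodSlice_apply (u : lp (fun _ : Zd d => ℝ) 2) (n k : Zd d) :
    periodSlice hL u n k = u (n + k * L) := rfl

lemma inner_eq_sum_inner_periodSlice (u w : lp (fun _ : Zd d => ℝ) 2) :
    inner ℝ u w = ∑ c : dbox a (fun i => a i + L i - 1),
      inner ℝ (periodSlice hL u c) (periodSlice hL w c) := by
  have hs := (cellEquiv a hL).summable_iff.mpr (lp.summable_inner (𝕜 := ℝ) u w)
  rw [lp.inner_eq_tsum, ← (cellEquiv a hL).tsum_eq]
  refine (hs.tsum_prod).trans ?_
  rw [tsum_fintype]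
  refine sum_congr rfl fun c _ => ?_
  rw [lp.inner_eq_tsum]
  rfl

lemma norm_periodSlice_add_mul (u : lp (fun _ : Zd d => ℝ) 2) (n j : Zd d) :
    ‖periodSlice hL u (n + j * L)‖ = ‖periodSlice hL u n‖ := by
  rw [← sq_eq_sq₀ (norm_nonneg _) (norm_nonneg _), ← real_inner_self_eq_norm_sq,
    ← real_inner_self_eq_norm_sq, lp.inner_eq_tsum, lp.inner_eq_tsum,
    ← (Equiv.addLeft j).tsum_eq fun k => inner ℝ (periodSlice hL u n k) (periodSlice hL u n k)]
  simp only [periodSlice_apply, Equiv.coe_addLeft, add_mul, add_assoc]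

lemma norm_periodSlice_reduceTo (u : lp (fun _ : Zd d => ℝ) 2) (n : Zd d) :
    ‖periodSlice hL u (reduceTo a L n)‖ = ‖periodSlice hL u n‖ := by
  conv_rhs => rw [← reduceTo_add_quotient a (L := L) n]
  rw [norm_periodSlice_add_mul]

variable {V : Zd d → ℝ}
  {H : lp (fun _ : Zd d => ℝ) 2 →L[ℝ] lp (fun _ : Zd d => ℝ) 2}
  (hH : ∀ (u : lp (fun _ : Zd d => ℝ) 2) (n : Zd d),
    (H u) n = (-∑ j ∈ nbhd n, u j) + V n * u n)

include hH in
lemma periodSlice_schrodinger (hper : ∀ n k : Zd d, V (n + k * L) = V n)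
    (u : lp (fun _ : Zd d => ℝ) 2) (n : Zd d) :
    periodSlice hL (H u) n = -∑ m ∈ nbhd n, periodSlice hL u m + V n • periodSlice hL u n := by
  ext k
  rw [periodSlice_apply, hH, sum_nbhd_add, hper, lp.coeFn_add, lp.coeFn_neg, lp.coeFn_smul,
    lp.coeFn_sum]
  simp [Finset.sum_apply]

include hL hH in
lemma mul_norm_sq_le_inner_schrodinger (hper : ∀ n k : Zd d, V (n + k * L) = V n) {E : ℝ}
    (hE : ∀ w, E * (w ⬝ᵥ w) ≤ w ⬝ᵥ (periodicMat a L V).mulVec w)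
    (u : lp (fun _ : Zd d => ℝ) 2) :
    E * ‖u‖ ^ 2 ≤ inner ℝ u (H u) := by
  calc E * ‖u‖ ^ 2
      = E * ((fun c : dbox a (fun i => a i + L i - 1) => ‖periodSlice hL u c‖) ⬝ᵥ
          fun c => ‖periodSlice hL u c‖) := by
        rw [← real_inner_self_eq_norm_sq, inner_eq_sum_inner_periodSlice a hL, dotProduct]
        simp only [real_inner_self_eq_norm_mul_norm]
    _ ≤ _ := hE _
    _ ≤ inner ℝ u (H u) := by
        rw [inner_eq_sum_inner_periodSlice a hL, dotProduct]
        refine sum_le_sum fun c _ => ?_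
        rw [periodicMat_mulVec a hL V (f := fun n => ‖periodSlice hL u n‖)
            (norm_periodSlice_reduceTo a hL u) c,
          periodSlice_schrodinger hL hH hper, inner_add_right, inner_neg_right, inner_sum,
          real_inner_smul_right, real_inner_self_eq_norm_mul_norm, mul_add, mul_neg, mul_sum,
          mul_left_comm]
        gcongr
        exact real_inner_le_norm _ _

end LowerBound

section UpperBound

open Finset

variable {d : ℕ}

lemma summable_prod_apply {ι κ : Type*} [Fintype ι] [DecidableEq ι] {f : κ → ℝ}
    (hf : Summable f) (h0 : ∀ k, 0 ≤ f k) :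
    Summable fun n : ι → κ => ∏ i, f (n i) := by
  classical
  refine summable_of_sum_le (c := ∏ _i : ι, ∑' k, f k)
    (fun n => prod_nonneg fun i _ => h0 _) fun s => ?_
  calc ∑ n ∈ s, ∏ i, f (n i)
      ≤ ∑ n ∈ Fintype.piFinset fun i => s.image fun n => n i, ∏ i, f (n i) :=
        sum_le_sum_of_subset_of_nonneg
          (fun n hn => Fintype.mem_piFinset.mpr fun i => mem_image_of_mem _ hn)
          fun n _ _ => prod_nonneg fun i _ => h0 _
    _ = ∏ i, ∑ k ∈ s.image fun n => n i, f k :=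
        (prod_univ_sum _ _).symm
    _ ≤ _ := prod_le_prod (fun i _ => sum_nonneg fun k _ => h0 k)
        fun i _ => hf.sum_le_tsum _ fun k _ => h0 k

/-- An exponentially decaying cutoff function on the lattice. -/
def cutoff (ε : ℝ) (n : Zd d) : ℝ := Real.exp (-ε * dist1 n 0)

lemma cutoff_pos (ε : ℝ) (n : Zd d) : 0 < cutoff ε n := Real.exp_pos _

lemma summable_cutoff {ε : ℝ} (hε : 0 < ε) : Summable (cutoff (d := d) ε) := by
  have h1 : Summable fun k : ℤ => Real.exp (-ε * |(k : ℝ)|) := by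
    have h : Summable fun k : ℕ => Real.exp (-ε * |((k : ℤ) : ℝ)|) := by
      refine (Real.summable_exp_nat_mul_iff.mpr (neg_lt_zero.mpr hε)).congr fun k => ?_
      rw [Int.cast_natCast, Nat.abs_cast, mul_comm]
    exact .of_nat_of_neg h (by simpa using h)
  refine (summable_prod_apply (ι := Fin d) h1 fun _ => (Real.exp_pos _).le).congr fun n => ?_
  rw [cutoff, ← Real.exp_sum, ← mul_sum]
  simp [dist1]

lemma abs_cutoff_sub_le {ε : ℝ} (hε : 0 < ε) {n m : Zd d} (h : m ∈ nbhd n) :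
    |cutoff ε m - cutoff ε n| ≤ (Real.exp ε - 1) * cutoff ε m := by
  have htri : ∀ x y : Zd d, dist1 x 0 ≤ dist1 x y + dist1 y 0 := fun x y => by
    simp only [dist1, ← sum_add_distrib]
    exact sum_le_sum fun i _ => abs_sub_le _ _ _
  have hratio : ∀ x y : Zd d, dist1 x y = 1 → cutoff ε x ≤ Real.exp ε * cutoff ε y := by
    intro x y hxy
    have := htri y x
    rw [dist1_comm y x, hxy] at this
    have : (dist1 y 0 : ℝ) ≤ 1 + dist1 x 0 := by exact_mod_cast this
    rw [cutoff, cutoff, ← Real.exp_add]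
    gcongr
    nlinarith
  rw [mem_nbhd_iff] at h
  have h₁ := hratio n m h
  have h₂ := hratio m n (dist1_comm n m ▸ h)
  have he : 1 ≤ Real.exp ε := Real.one_le_exp hε.le
  have hm := cutoff_pos ε m
  rw [abs_le]
  constructor <;> nlinarith

variable {V : Zd d → ℝ}
  {H : lp (fun _ : Zd d => ℝ) 2 →L[ℝ] lp (fun _ : Zd d => ℝ) 2}
  (hH : ∀ (u : lp (fun _ : Zd d => ℝ) 2) (n : Zd d),
    (H u) n = (-∑ j ∈ nbhd n, u j) + V n * u n)

include hH in
lemma abs_potential_le_opNorm (n : Zd d) : |V n| ≤ ‖H‖ := by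
  have h : (H (lp.single 2 n (1 : ℝ))) n = V n := by
    rw [hH, sum_eq_zero]
    · simp
    · intro m hm
      rw [lp.coeFn_single, Pi.single_eq_of_ne]
      rintro rfl
      exact notMem_nbhd_self m hm
  calc |V n| = ‖(H (lp.single 2 n (1 : ℝ))) n‖ := by rw [h, Real.norm_eq_abs]
    _ ≤ ‖H (lp.single 2 n (1 : ℝ))‖ := lp.norm_apply_le_norm (by norm_num) _ _
    _ ≤ ‖H‖ * ‖lp.single (E := fun _ : Zd d => ℝ) 2 n (1 : ℝ)‖ := H.le_opNorm _
    _ = ‖H‖ := by rw [lp.norm_single (by norm_num)]; simp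

include hH in
lemma sum_nbhd_abs_le (u : lp (fun _ : Zd d => ℝ) 2) (n : Zd d) :
    ∑ m ∈ nbhd n, |u m| ≤ ‖H‖ * |u n| + |(H (lp.toNorm u)) n| := by
  have h := hH (lp.toNorm u) n
  simp only [lp.toNorm_coe, Real.norm_eq_abs] at h
  have hV := (le_abs_self _).trans (abs_potential_le_opNorm hH n)
  have h₁ := mul_le_mul_of_nonneg_right hV (abs_nonneg (u n))
  linarith [neg_le_abs ((H (lp.toNorm u)) n)]

include hH in
lemma norm_schrodinger_sub_smul_le {E ε : ℝ} (hε : 0 < ε) {φ : Zd d → ℝ}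
    (hφ : ∀ n, (-∑ m ∈ nbhd n, φ m) + V n * φ n = E * φ n)
    (u : lp (fun _ : Zd d => ℝ) 2) (hu : ∀ n, u n = φ n * cutoff ε n) :
    ‖H u - E • u‖ ≤ (Real.exp ε - 1) * (2 * ‖H‖) * ‖u‖ := by
  have hδ : 0 ≤ Real.exp ε - 1 := sub_nonneg.mpr (Real.one_le_exp hε.le)
  have hpt : ∀ n, ‖(H u - E • u) n‖ ≤
      ‖((Real.exp ε - 1) • (‖H‖ • lp.toNorm u + lp.toNorm (H (lp.toNorm u)))) n‖ := by
    intro n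
    have heq : (H u - E • u) n = -∑ m ∈ nbhd n, φ m * (cutoff ε m - cutoff ε n) := by
      have h : (H u - E • u) n = (-∑ m ∈ nbhd n, u m) + V n * u n - E * u n := by
        rw [lp.coeFn_sub, Pi.sub_apply, hH]
        rfl
      simp only [h, hu, mul_sub, sum_sub_distrib, ← sum_mul]
      linear_combination cutoff ε n * hφ n
    calc ‖(H u - E • u) n‖ ≤ ∑ m ∈ nbhd n, |φ m * (cutoff ε m - cutoff ε n)| := by
          rw [heq, norm_neg]
          exact abs_sum_le_sum_abs _ _
      _ ≤ ∑ m ∈ nbhd n, (Real.exp ε - 1) * |u m| := by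
          refine sum_le_sum fun m hm => ?_
          rw [hu, abs_mul, abs_mul, abs_of_pos (cutoff_pos ε m), mul_left_comm]
          exact mul_le_mul_of_nonneg_left (abs_cutoff_sub_le hε hm) (abs_nonneg _)
      _ = (Real.exp ε - 1) * ∑ m ∈ nbhd n, |u m| := (mul_sum ..).symm
      _ ≤ (Real.exp ε - 1) * (‖H‖ * |u n| + |(H (lp.toNorm u)) n|) :=
          mul_le_mul_of_nonneg_left (sum_nbhd_abs_le hH u n) hδ
      _ ≤ _ := le_abs_self _
  calc ‖H u - E • u‖
      ≤ ‖(Real.exp ε - 1) • (‖H‖ • lp.toNorm u + lp.toNorm (H (lp.toNorm u)))‖ :=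
        lp.norm_mono (by norm_num) hpt
    _ = (Real.exp ε - 1) * ‖‖H‖ • lp.toNorm u + lp.toNorm (H (lp.toNorm u))‖ := by
        rw [norm_smul, Real.norm_of_nonneg hδ]
    _ ≤ (Real.exp ε - 1) * (‖H‖ * ‖u‖ + ‖H‖ * ‖u‖) := by
        gcongr
        refine (norm_add_le _ _).trans ?_
        rw [norm_smul, norm_norm, lp.norm_toNorm, lp.norm_toNorm]
        gcongr
        simpa only [lp.norm_toNorm] using H.le_opNorm (lp.toNorm u)
    _ = _ := by ring

lemma memℓp_mul_cutoff {ε C : ℝ} (hε : 0 < ε) {φ : Zd d → ℝ} (hC : ∀ n, |φ n| ≤ C) :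
    Memℓp (fun n => φ n * cutoff ε n) 2 := by
  have h : Memℓp (cutoff (d := d) ε) 2 := by
    refine Memℓp.of_exponent_ge (p := 2) (q := 1) (memℓp_gen ?_) (by norm_num)
    simpa [abs_of_pos, cutoff_pos] using summable_cutoff (d := d) hε
  refine (h.const_smul C).mono fun n => ?_
  rw [norm_mul, Real.norm_of_nonneg (cutoff_pos ε n).le]
  exact mul_le_mul_of_nonneg_right (hC n) (cutoff_pos ε n).le

include hH in
lemma mem_spectrum_schrodinger {E C : ℝ} {φ : Zd d → ℝ} (hφ0 : φ ≠ 0) (hC : ∀ n, |φ n| ≤ C)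
    (hφ : ∀ n, (-∑ m ∈ nbhd n, φ m) + V n * φ n = E * φ n) : E ∈ spectrum ℝ H := by
  refine mem_spectrum_of_forall_exists_norm_le fun η hη => ?_
  have hlim : Filter.Tendsto (fun ε => (Real.exp ε - 1) * (2 * ‖H‖))
      (nhdsWithin 0 (Set.Ioi 0)) (nhds 0) := by
    have : Continuous fun ε => (Real.exp ε - 1) * (2 * ‖H‖) := by fun_prop
    simpa using (this.tendsto 0).mono_left nhdsWithin_le_nhds
  obtain ⟨ε, hlt, hε⟩ := ((hlim.eventually_lt_const hη).and self_mem_nhdsWithin).exists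
  let u : lp (fun _ : Zd d => ℝ) 2 := ⟨_, memℓp_mul_cutoff hε hC⟩
  refine ⟨u, fun h => hφ0 (funext fun n => ?_), ?_⟩
  · have hn : φ n * cutoff ε n = 0 := congrFun (congrArg Subtype.val h) n
    exact (mul_eq_zero.mp hn).resolve_right (cutoff_pos ε n).ne'
  · exact (norm_schrodinger_sub_smul_le hH hε hφ u fun _ => rfl).trans
      (mul_le_mul_of_nonneg_right hlt.le (norm_nonneg _))

end UpperBound

/-- **The spectral minimum of a periodic discrete Schrödinger operator is the lowest
periodic eigenvalue.**  If `V : ℤ^d → ℝ` is `L`-periodic and `C = ∏ [a i, a i + L i - 1]`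
is any period cell, then `inf σ(h₀ + V) = min σ(h^P_{0,C} + V|_C)`. -/
theorem periodic_spectral_minimum
    (d : ℕ) (hd : 1 ≤ d)
    (L : Zd d) (hL : ∀ i, 0 < L i)
    (V : Zd d → ℝ)
    (hper : ∀ n k : Zd d, V (fun i => n i + k i * L i) = V n)
    (a : Zd d)
    (H : lp (fun _ : Zd d => ℝ) 2 →L[ℝ] lp (fun _ : Zd d => ℝ) 2)
    (hH : ∀ (u : lp (fun _ : Zd d => ℝ) 2) (n : Zd d),
      (H u) n = (-∑ j ∈ nbhd n, u j) + V n * u n) :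
    sInf (spectrum ℝ H) = sInf (spectrum ℝ (periodicMat a L V)) := by
  have hper' : ∀ n k : Zd d, V (n + k * L) = V n := hper
  obtain ⟨E, hleast, ⟨v, hv0, hv⟩, hE⟩ := exists_isLeast_spectrum_periodicMat a hL V
  set φ : Zd d → ℝ := fun n => v ⟨reduceTo a L n, reduceTo_mem a hL n⟩
  have hφadd : ∀ n k, φ (n + k * L) = φ n := fun n k =>
    congrArg v (Subtype.ext (reduceTo_add_mul a n k))
  have hφcell : ∀ c : dbox a (fun i => a i + L i - 1), φ c = v c := fun c =>
    congrArg v (Subtype.ext (reduceTo_of_mem a c.2))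
  have hφred : ∀ n, φ (reduceTo a L n) = φ n := fun n => hφcell ⟨_, reduceTo_mem a hL n⟩
  have hφ0 : φ ≠ 0 := fun h => hv0 (funext fun c => by rw [← hφcell, h]; rfl)
  obtain ⟨C, hC⟩ := (Set.finite_range fun c => |v c|).bddAbove
  have hφ : ∀ n, (-∑ m ∈ nbhd n, φ m) + V n * φ n = E * φ n := by
    intro n
    have h := periodicMat_mulVec a hL V hφred ⟨_, reduceTo_mem a hL n⟩
    simp only [hφcell, hφred] at h
    rw [hv, Pi.smul_apply, smul_eq_mul] at h
    rw [← reduceTo_add_quotient a (L := L) n, sum_nbhd_add, hper']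
    simp only [hφadd, hφred]
    exact h.symm
  have hH' : IsLeast (spectrum ℝ H) E :=
    ⟨mem_spectrum_schrodinger hH hφ0 (fun n => hC ⟨_, rfl⟩) hφ, fun x hx =>
      le_of_mem_spectrum_of_forall_le_inner
        (mul_norm_sq_le_inner_schrodinger a hL hH hper' hE) hx⟩
  rw [hH'.csInf_eq, hleast.csInf_eq]
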